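/- Under the NOD setup (see context), for every integer K ≥ 2, (μ/2)·‖z̃_{K−1} − z⋆‖² ≤ (1 − √(ημ))^{K−2} · Ψ_2; in particular, ‖z̃_{K−1} − z⋆‖² converges to 0 linearly with contraction factor 1 − √(ημ). -/

import Mathlib

open scoped RealInnerProductSpace

section nodaux
variable {E : Type*} [NormedAddCommGroup E] [InnerProductSpace ℝ E]

theorem nod_step (m q s : ℝ) (hs : s = m ^ 2 * q) (hs0 : 0 < s) (hs1 : s < 1)
    (y x x' g gp f T zh : E) (a a' D : ℝ)
    (hy : s • (y - x) = x - x' + (q * m) ^ 2 • gp)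
    (hzh : (1 - s) • y + s • x - zh = (q * (1 - s)) • gp)
    (hg : g = f + T)
    (h1 : ⟪f, x⟫ ≥ a + m ^ 2 / 2 * ‖x‖ ^ 2)
    (h2 : ⟪f, x - x'⟫ ≥ a - a' + D)
    (h3 : ⟪T, zh⟫ ≥ 0) :
    m ^ 2 * ‖(1 - s) • y + s • x - q • g‖ ^ 2 + 2 * a - (q * m) ^ 2 * ‖g‖ ^ 2 ≤
      (1 - s) * (m ^ 2 * ‖y‖ ^ 2 + 2 * a' - (q * m) ^ 2 * ‖gp‖ ^ 2)
      - m ^ 2 * s * (1 - s) * ‖y - x‖ ^ 2 - 2 * (1 - s) * D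
      + (1 - s) * (q * m) ^ 2 * (‖g - gp‖ ^ 2 - ‖g‖ ^ 2) := by
  have e1 : ⟪f, s • (y - x)⟫ = ⟪f, x - x' + (q * m) ^ 2 • gp⟫ := by rw [hy]
  have e2 : ⟪T, (1 - s) • y + s • x - zh⟫ = ⟪T, (q * (1 - s)) • gp⟫ := by rw [hzh]
  subst hg
  simp only [← real_inner_self_eq_norm_sq, inner_add_left, inner_add_right, inner_sub_left,
    inner_sub_right, inner_smul_left, inner_smul_right, conj_trivial] at *
  have c1 := real_inner_comm x y
  have c2 := real_inner_comm f y
  have c3 := real_inner_comm T y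
  have c4 := real_inner_comm f x
  have c5 := real_inner_comm T x
  have c6 := real_inner_comm f T
  have c7 := real_inner_comm f gp
  have c8 := real_inner_comm T gp
  rw [c1, c2, c3, c4, c5, c6, c7, c8]
  have i1 : 0 ≤ s * (⟪f, x⟫ - (a + m ^ 2 / 2 * ⟪x, x⟫)) := mul_nonneg hs0.le (by linarith)
  have i2 : 0 ≤ (1 - s) * (⟪f, x⟫ - ⟪f, x'⟫ - (a - a' + D)) :=
    mul_nonneg (by linarith) (by linarith)
  have i3 : 0 ≤ s * ⟪T, zh⟫ := mul_nonneg hs0.le h3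
  have e1' := congrArg (fun t => (1 - s) * t) e1
  have e2' := congrArg (fun t => s * t) e2
  beta_reduce at e1' e2'
  subst hs
  linarith

set_option maxHeartbeats 1600000 in
theorem nod_scalar (C c b M s τ V G G0 : ℝ) (hc : 0 < c) (hC : C = c ^ 2)
    (hceq : 1 - c ^ 2 - c * (c ^ 2 + 6) = 0)
    (hb1 : c ≤ b) (hb2 : b * (C + 6) ≤ 1)
    (hM : M * (1 - 2 * C) = 2 * C)
    (hs0 : 0 < s) (hs1 : s ≤ c) (hτ : τ * (1 + s) = 1 - s) :
    M * (τ * V + 2 / (1 + s) * G + (1 - s) * G0) ^ 2 + 2 * τ ^ 2 * (V ^ 2 + s ^ 2 * G ^ 2) ≤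
      (1 / 2 - b) * G ^ 2 + (1 - s ^ 2) / s * V ^ 2 + b * (1 - s) * G0 ^ 2 := by
  have hcl : 0.1616 < c := by nlinarith only [sq_nonneg c, hc, hceq]
  have hcu : c < 0.16162 := by nlinarith only [sq_nonneg c, hc, hceq]
  have hCl : 0.0261 < C := by rw [hC]; nlinarith only [hcl]
  have hCu : C < 0.02613 := by rw [hC]; nlinarith only [hcu, hc]
  have hM0 : 0 < M := by
    have h : 0 < M * (1 - 2 * C) := by rw [hM]; linarith
    exact (pos_iff_pos_of_mul_pos h).2 (by linarith)
  have hMu : M < 0.05515 := by nlinarith only [hM, hCu, hM0]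
  have hbl : 0.1616 < b := by linarith
  have hbu : b < 0.166 := by nlinarith only [hb2, hCl, hbl]
  have hτ0 : 0 < τ := by
    have h : 0 < τ * (1 + s) := by rw [hτ]; linarith
    exact (pos_iff_pos_of_mul_pos h).2 (by linarith)
  have hτ1 : τ ≤ 1 := by nlinarith only [hτ, hs0, hτ0]
  obtain ⟨u, hu⟩ : ∃ u, u = G / (1 + s) := ⟨_, rfl⟩
  have hG : G = u * (1 + s) := by rw [hu]; field_simp
  have hG' : 2 / (1 + s) * G = 2 * u := by rw [hu]; ring
  obtain ⟨w, hw⟩ : ∃ w, w = (1 - s) * G0 := ⟨_, rfl⟩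
  obtain ⟨t, ht⟩ : ∃ t, t = τ * V := ⟨_, rfl⟩
  rw [hG', ← hw, ← ht]
  -- two-variable part
  have k1 : M * (2 * u + w) ^ 2 ≤ (1 / 2 - b) * u ^ 2 + b * w ^ 2 := by
    have d1 : 0 < b - M := by linarith
    have d2 : 4 * M ^ 2 ≤ (1 / 2 - b - 4 * M) * (b - M) := by nlinarith only [hMu, hM0, hbl, hbu]
    have : 0 ≤ (b - M) * ((1 / 2 - b) * u ^ 2 + b * w ^ 2 - M * (2 * u + w) ^ 2) := by
      nlinarith only [sq_nonneg ((b - M) * w - 2 * M * u), mul_nonneg (sub_nonneg.2 d2) (sq_nonneg u)]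
    have := nonneg_of_mul_nonneg_right this d1
    linarith
  have k2 : s * (t + (2 * u + w)) ^ 2 ≤ (1 + s) * t ^ 2 + s * (1 + s) * (2 * u + w) ^ 2 := by
    nlinarith only [hs0, sq_nonneg (t - s * (2 * u + w))]
  have k3 : (t + (2 * u + w)) ^ 2 ≤ (1 + 1 / s) * t ^ 2 + (1 + s) * (2 * u + w) ^ 2 := by
    have : (1 + 1 / s) * t ^ 2 + (1 + s) * (2 * u + w) ^ 2
       = ((1 + s) * t ^ 2 + s * (1 + s) * (2 * u + w) ^ 2) / s := by field_simp; ring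
    rw [this, le_div_iff₀ hs0]; linarith
  have k4 : M * (1 + 1 / s) * t ^ 2 + 2 * τ ^ 2 * V ^ 2 ≤ (1 - s ^ 2) / s * V ^ 2 := by
    have l1 : t ^ 2 ≤ V ^ 2 := by
      rw [ht, mul_pow]
      exact mul_le_of_le_one_left (sq_nonneg V) (pow_le_one₀ hτ0.le hτ1)
    have l2 : 2 * τ ^ 2 * V ^ 2 ≤ 2 * V ^ 2 := by
      have := mul_le_of_le_one_left (sq_nonneg V) (pow_le_one₀ (n := 2) hτ0.le hτ1)
      linarith
    have l3 : M * (1 + 1 / s) * t ^ 2 ≤ M * (1 + 1 / s) * V ^ 2 := by gcongr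
    have l4 : M * (1 + 1 / s) + 2 ≤ (1 - s ^ 2) / s := by
      rw [le_div_iff₀ hs0]
      have : (M * (1 + 1 / s) + 2) * s = M * (s + 1) + 2 * s := by field_simp
      rw [this]; nlinarith only [hs0, hs1, hcu, hMu, hM0]
    linarith [mul_le_mul_of_nonneg_right l4 (sq_nonneg V)]
  have k5 : (1 + s) * (b * w ^ 2) ≤ b * (1 - s) * G0 ^ 2 := by
    rw [hw]
    have : (1 + s) * (1 - s) ≤ 1 := by nlinarith only [hs0]
    have h2 : 0 ≤ b * (1 - s) * G0 ^ 2 := by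
      have : 0 ≤ 1 - s := by linarith
      positivity
    have h3 := mul_le_mul_of_nonneg_right this h2
    linarith
  have k6 : (1 + s) * ((1 / 2 - b) * u ^ 2) + 2 * τ ^ 2 * (s ^ 2 * G ^ 2)
      ≤ (1 / 2 - b) * G ^ 2 := by
    have e : 2 * τ ^ 2 * (s ^ 2 * G ^ 2) = 2 * (1 - s) ^ 2 * s ^ 2 * u ^ 2 := by
      rw [hG, ← hτ]; ring
    rw [e, hG]
    have : 0 ≤ (1 / 2 - b) * (1 + s) ^ 2 - (1 + s) * (1 / 2 - b) - 2 * (1 - s) ^ 2 * s ^ 2 := by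
      have : (1 / 2 - b) * (1 + s) ^ 2 - (1 + s) * (1 / 2 - b) - 2 * (1 - s) ^ 2 * s ^ 2
        = s * ((1 / 2 - b) * (1 + s) - 2 * (1 - s) ^ 2 * s) := by ring
      rw [this]
      apply mul_nonneg hs0.le
      have : (1 - s) ^ 2 ≤ 1 := pow_le_one₀ (by linarith) (by linarith)
      have h1 := mul_le_mul_of_nonneg_right this hs0.le
      have h2 : 0 ≤ (1 / 2 - b) * s := mul_nonneg (by linarith) hs0.le
      linarith
    linarith [mul_nonneg this (sq_nonneg u)]
  have k7 := mul_le_mul_of_nonneg_left k3 hM0.le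
  have k8 := mul_le_mul_of_nonneg_left k1 (by linarith : 0 ≤ 1 + s)
  have k9 : τ * V = t := ht.symm
  have : t + 2 * u + w = t + (2 * u + w) := by ring
  rw [this]
  linarith

set_option maxHeartbeats 1600000 in
theorem nod_vec (C c b M s τ m q L LS : ℝ) (hc : 0 < c) (hC : C = c ^ 2)
    (hceq : 1 - c ^ 2 - c * (c ^ 2 + 6) = 0)
    (hb1 : c ≤ b) (hb2 : b * (C + 6) ≤ 1)
    (hM : M * (1 - 2 * C) = 2 * C) (hm : 0 < m) (hq : 0 < q) (hs : s = m ^ 2 * q)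
    (hs1 : s ≤ c) (hτ : τ * (1 + s) = 1 - s) (hL : 0 < L) (hLq : (q * m) ^ 2 * L ≤ C)
    (hLS : q * LS ≤ c) (hLS0 : 0 ≤ LS)
    (v1 v2 g0 g1 g2 F T zd : E)
    (hv2 : v2 = τ • (v1 - (q * m) ^ 2 • g1)) (hg : g2 = g1 + (F + T))
    (hT : ‖T‖ ≤ LS * ‖zd‖)
    (hzd : zd = -(τ • v1) - (2 / (1 + s) * q) • g1 + ((1 - s) * q) • g0) :
    m ^ 2 * ‖v2‖ ^ 2 - 1 / L * ‖F‖ ^ 2 + (q * m) ^ 2 * (‖g2 - g1‖ ^ 2 - ‖g2‖ ^ 2)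
      + b * (q * m) ^ 2 * ‖g1‖ ^ 2 ≤
     (1 - s ^ 2) / s * m ^ 2 * ‖v1‖ ^ 2 + b * (1 - s) * (q * m) ^ 2 * ‖g0‖ ^ 2 := by
  have hs0 : 0 < s := by rw [hs]; positivity
  have hcu : c < 0.16162 := by nlinarith only [sq_nonneg c, hc, hceq]
  have hC0 : 0 < C := by subst hC; positivity
  have hCu : C < 0.02613 := by rw [hC]; nlinarith only [hcu, hc]
  have hτ0 : 0 < τ := by
    have h : 0 < τ * (1 + s) := by rw [hτ]; linarith
    exact (pos_iff_pos_of_mul_pos h).2 (by linarith)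
  have hM0 : 0 < M := by
    have h : 0 < M * (1 - 2 * C) := by rw [hM]; linarith
    exact (pos_iff_pos_of_mul_pos h).2 (by linarith)
  have key := nod_scalar C c b M s τ (m * ‖v1‖) (q * m * ‖g1‖) (q * m * ‖g0‖) hc hC hceq hb1 hb2
    hM hs0 hs1 hτ
  -- v2
  have a1 : m ^ 2 * ‖v2‖ ^ 2 ≤ 2 * τ ^ 2 * ((m * ‖v1‖) ^ 2 + s ^ 2 * (q * m * ‖g1‖) ^ 2) := by
    have : ‖v1 - (q * m) ^ 2 • g1‖ ^ 2 ≤ 2 * (‖v1‖ ^ 2 + (q * m) ^ 4 * ‖g1‖ ^ 2) := by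
      have := norm_sub_le v1 ((q * m) ^ 2 • g1)
      rw [norm_smul, Real.norm_of_nonneg (by positivity)] at this
      have h0 := norm_nonneg (v1 - (q * m) ^ 2 • g1)
      have h2 := pow_le_pow_left₀ h0 this 2
      linarith [sq_nonneg (‖v1‖ - (q * m) ^ 2 * ‖g1‖)]
    rw [hv2, norm_smul, mul_pow, Real.norm_of_nonneg hτ0.le]
    have := mul_le_mul_of_nonneg_left this (by positivity : 0 ≤ m ^ 2 * τ ^ 2)
    subst hs
    linarith
  -- Delta
  have a2 : ‖g2 - g1‖ ^ 2 - ‖g2‖ ^ 2 ≤ 2 * ‖F + T‖ ^ 2 - 1 / 2 * ‖g1‖ ^ 2 := by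
    have e : g2 - g1 = F + T := by rw [hg]; abel
    rw [e, hg]
    have h0 := sq_nonneg ‖g1 + (2 : ℝ) • (F + T)‖
    have h1 := norm_add_sq_real g1 ((2 : ℝ) • (F + T))
    have h2 := norm_add_sq_real g1 (F + T)
    rw [inner_smul_right, norm_smul, Real.norm_of_nonneg (by norm_num)] at h1
    linarith
  have a3 : 2 * ((q * m) ^ 2 * ‖F + T‖ ^ 2) ≤ 1 / L * ‖F‖ ^ 2 + M / C * ((q * m) ^ 2 * ‖T‖ ^ 2) := by
    have h1 : 2 * ‖F + T‖ ^ 2 ≤ 1 / C * ‖F‖ ^ 2 + M / C * ‖T‖ ^ 2 := by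
      have hn := norm_add_le F T
      have hMC : M / C = 2 / (1 - 2 * C) := by
        rw [div_eq_div_iff hC0.ne' (by linarith)]; linarith
      rw [hMC]
      have : 2 * ‖F + T‖ ^ 2 ≤ 2 * (‖F‖ + ‖T‖) ^ 2 := by gcongr
      refine this.trans ?_
      have hp : 0 < 1 - 2 * C := by linarith
      have : 1 / C * ‖F‖ ^ 2 + 2 / (1 - 2 * C) * ‖T‖ ^ 2 - 2 * (‖F‖ + ‖T‖) ^ 2
        = ((1 - 2 * C) * ‖F‖ - 2 * C * ‖T‖) ^ 2 / (C * (1 - 2 * C)) := by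
        obtain ⟨e, he⟩ : ∃ e, e = 1 - 2 * C := ⟨_, rfl⟩
        rw [← he] at hp ⊢
        have hp' := hp.ne'
        have hC' := hC0.ne'
        field_simp
        rw [he]
        ring
      have : 0 ≤ ((1 - 2 * C) * ‖F‖ - 2 * C * ‖T‖) ^ 2 / (C * (1 - 2 * C)) := by positivity
      linarith
    have h2 : (q * m) ^ 2 * (1 / C) ≤ 1 / L := by
      rw [mul_one_div, div_le_div_iff₀ hC0 hL]; linarith
    have h3 := mul_le_mul_of_nonneg_left h1 (by positivity : 0 ≤ (q * m) ^ 2)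
    have h4 := mul_le_mul_of_nonneg_right h2 (sq_nonneg ‖F‖)
    linarith
  have a4 : M / C * ((q * m) ^ 2 * ‖T‖ ^ 2) ≤ M * (τ * (m * ‖v1‖) + 2 / (1 + s) * (q * m * ‖g1‖)
      + (1 - s) * (q * m * ‖g0‖)) ^ 2 := by
    have n1 : ‖zd‖ ≤ τ * ‖v1‖ + 2 / (1 + s) * q * ‖g1‖ + (1 - s) * q * ‖g0‖ := by
      rw [hzd]
      refine (norm_add_le _ _).trans ?_
      have := norm_sub_le (-(τ • v1)) ((2 / (1 + s) * q) • g1)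
      have hp : 0 ≤ (1 - s) * q := mul_nonneg (by linarith) hq.le
      have hp2 : 0 ≤ 2 / (1 + s) * q := by positivity
      rw [norm_neg, norm_smul, norm_smul, Real.norm_of_nonneg hτ0.le, Real.norm_of_nonneg hp2]
        at this
      rw [norm_smul ((1 - s) * q), Real.norm_of_nonneg hp]
      linarith
    have n2 : q * m * ‖T‖ ≤ c * (τ * (m * ‖v1‖) + 2 / (1 + s) * (q * m * ‖g1‖)
      + (1 - s) * (q * m * ‖g0‖)) := by
      calc q * m * ‖T‖ ≤ q * m * (LS * ‖zd‖) := by gcongr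
        _ = (q * LS) * (m * ‖zd‖) := by ring
        _ ≤ c * (m * ‖zd‖) := by gcongr
        _ ≤ c * (m * (τ * ‖v1‖ + 2 / (1 + s) * q * ‖g1‖ + (1 - s) * q * ‖g0‖)) := by gcongr
        _ = _ := by ring
    have n3 := pow_le_pow_left₀ (by positivity) n2 2
    rw [mul_pow, mul_pow c, ← hC] at n3
    calc M / C * ((q * m) ^ 2 * ‖T‖ ^ 2) ≤ M / C * (C * (τ * (m * ‖v1‖) + 2 / (1 + s) * (q * m * ‖g1‖)
      + (1 - s) * (q * m * ‖g0‖)) ^ 2) := by gcongr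
      _ = _ := by field_simp
  have a5 := mul_le_mul_of_nonneg_left a2 (by positivity : 0 ≤ (q * m) ^ 2)
  have e1 : (1 - s ^ 2) / s * (m * ‖v1‖) ^ 2 = (1 - s ^ 2) / s * m ^ 2 * ‖v1‖ ^ 2 := by ring
  rw [e1] at key
  linarith

/-- descent lemma -/
theorem nod_descent [CompleteSpace E] (φ : E → ℝ) (L : ℝ) (hd : Differentiable ℝ φ)
    (hL : ∀ u v, ‖gradient φ u - gradient φ v‖ ≤ L * ‖u - v‖) (u v : E) :
    φ v ≤ φ u + ⟪gradient φ u, v - u⟫ + L / 2 * ‖v - u‖ ^ 2 := by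
  let F : ℝ → ℝ := fun t => φ (u + t • (v - u)) - t * ⟪gradient φ u, v - u⟫
    - t ^ 2 * (L / 2 * ‖v - u‖ ^ 2)
  have hF : ∀ t, HasDerivAt F (⟪gradient φ (u + t • (v - u)), v - u⟫ - ⟪gradient φ u, v - u⟫
      - 2 * t * (L / 2 * ‖v - u‖ ^ 2)) t := by
    intro t
    have h1 : HasDerivAt (fun t : ℝ => u + t • (v - u)) (v - u) t := by
      simpa using ((hasDerivAt_id t).smul_const (v - u)).const_add u
    have h2 := (hd (u + t • (v - u))).hasGradientAt.hasFDerivAt.comp_hasDerivAt t h1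
    have h3 := (hasDerivAt_id t).mul_const ⟪gradient φ u, v - u⟫
    have h4 := ((hasDerivAt_id t).pow 2).mul_const (L / 2 * ‖v - u‖ ^ 2)
    have := (h2.sub h3).sub h4
    refine HasDerivAt.congr_deriv (f := F) this ?_
    simp
  have hanti : AntitoneOn F (Set.Icc 0 1) := by
    apply antitoneOn_of_deriv_nonpos (convex_Icc 0 1)
    · exact fun t _ => (hF t).continuousAt.continuousWithinAt
    · exact fun t _ => (hF t).differentiableAt.differentiableWithinAt
    · intro t ht
      rw [interior_Icc] at ht
      rw [(hF t).deriv, ← inner_sub_left]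
      have h1 := real_inner_le_norm (gradient φ (u + t • (v - u)) - gradient φ u) (v - u)
      have h2 := hL (u + t • (v - u)) u
      rw [add_sub_cancel_left, norm_smul, Real.norm_of_nonneg ht.1.le] at h2
      have h3 := mul_le_mul_of_nonneg_right h2 (norm_nonneg (v - u))
      nlinarith
  have := hanti (by simp) (by simp) (zero_le_one)
  simp only [F, one_smul, zero_smul, add_zero, add_sub_cancel] at this
  linarith

theorem nod_coco [CompleteSpace E] (φ : E → ℝ) (L : ℝ) (hL0 : 0 < L) (hd : Differentiable ℝ φ)
    (hL : ∀ u v, ‖gradient φ u - gradient φ v‖ ≤ L * ‖u - v‖)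
    (hc : ∀ u v, φ v ≥ φ u + ⟪gradient φ u, v - u⟫) (u v : E) :
    φ v ≥ φ u + ⟪gradient φ u, v - u⟫ + 1 / (2 * L) * ‖gradient φ u - gradient φ v‖ ^ 2 := by
  have h1 := nod_descent φ L hd hL v (v + (1 / L) • (gradient φ u - gradient φ v))
  have h2 := hc u (v + (1 / L) • (gradient φ u - gradient φ v))
  have e : v + (1 / L) • (gradient φ u - gradient φ v) - u
    = (v - u) + (1 / L) • (gradient φ u - gradient φ v) := by abel
  rw [e, inner_add_right] at h2
  rw [add_sub_cancel_left, norm_smul, Real.norm_of_nonneg (by positivity)] at h1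
  have h3 : ⟪gradient φ u, (1 / L) • (gradient φ u - gradient φ v)⟫
    - ⟪gradient φ v, (1 / L) • (gradient φ u - gradient φ v)⟫ =
      1 / L * ‖gradient φ u - gradient φ v‖ ^ 2 := by
    rw [← inner_sub_left, inner_smul_right, real_inner_self_eq_norm_sq]
  have h4 : L / 2 * (1 / L * ‖gradient φ u - gradient φ v‖) ^ 2
    = 1 / (2 * L) * ‖gradient φ u - gradient φ v‖ ^ 2 := by field_simp
  have h5 : 1 / L * ‖gradient φ u - gradient φ v‖ ^ 2
    = 1 / (2 * L) * ‖gradient φ u - gradient φ v‖ ^ 2 + 1 / (2 * L) * ‖gradient φ u - gradient φ v‖ ^ 2 := by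
    field_simp; norm_num
  linarith

set_option maxHeartbeats 1600000 in
theorem nod_pos (C c b s m q L LS a : ℝ) (hc : 0 < c) (hC : C = c ^ 2)
    (hceq : 1 - c ^ 2 - c * (c ^ 2 + 6) = 0)
    (hb1 : c ≤ b) (hm : 0 < m) (hq : 0 < q) (hs0 : 0 < s)
    (hs1 : s ≤ c) (hL : 0 < L) (hLq : (q * m) ^ 2 * L ≤ C)
    (hLS : q * LS ≤ c) (hLS0 : 0 ≤ LS) (ha : 0 ≤ a)
    (y g0 g f T zh : E) (hg : g = f + T) (hf : ‖f‖ ^ 2 ≤ 2 * L * a)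
    (hT : ‖T‖ ≤ LS * ‖zh‖) (hzh : zh = y + q • g - (q * (1 - s)) • g0) :
    a ≤ m ^ 2 * ‖y‖ ^ 2 + 2 * a - (q * m) ^ 2 * ‖g‖ ^ 2 + b * (1 - s) * (q * m) ^ 2 * ‖g0‖ ^ 2 := by
  have hcl : 0.1616 < c := by nlinarith only [sq_nonneg c, hc, hceq]
  have hcu : c < 0.16162 := by nlinarith only [sq_nonneg c, hc, hceq]
  obtain ⟨A, hA⟩ : ∃ A, A = Real.sqrt (2 * a) := ⟨_, rfl⟩
  have hA0 : 0 ≤ A := hA ▸ Real.sqrt_nonneg _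
  have hA2 : A ^ 2 = 2 * a := by rw [hA, Real.sq_sqrt (by linarith)]
  have f1 : q * m * ‖f‖ ≤ c * A := by
    refine (sq_le_sq₀ (by positivity) (by positivity)).1 ?_
    calc (q * m * ‖f‖) ^ 2 = (q * m) ^ 2 * ‖f‖ ^ 2 := by ring
      _ ≤ (q * m) ^ 2 * (2 * L * a) := by gcongr
      _ = ((q * m) ^ 2 * L) * (2 * a) := by ring
      _ ≤ C * (2 * a) := by gcongr
      _ = (c * A) ^ 2 := by rw [mul_pow, hA2, hC]
  have n1 : ‖zh‖ ≤ ‖y‖ + q * ‖g‖ + q * (1 - s) * ‖g0‖ := by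
    rw [hzh]
    refine (norm_sub_le _ _).trans ?_
    have := norm_add_le y (q • g)
    have hp : 0 ≤ q * (1 - s) := mul_nonneg hq.le (by linarith)
    rw [norm_smul, Real.norm_of_nonneg hq.le] at this
    rw [norm_smul, Real.norm_of_nonneg hp]
    linarith
  have n2 : q * m * ‖T‖ ≤ c * (m * ‖y‖ + q * m * ‖g‖ + (1 - s) * (q * m * ‖g0‖)) := by
    calc q * m * ‖T‖ ≤ q * m * (LS * ‖zh‖) := by gcongr
      _ = (q * LS) * (m * ‖zh‖) := by ring
      _ ≤ c * (m * ‖zh‖) := by gcongr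
      _ ≤ c * (m * (‖y‖ + q * ‖g‖ + q * (1 - s) * ‖g0‖)) := by gcongr
      _ = _ := by ring
  have n3 : ‖g‖ ≤ ‖f‖ + ‖T‖ := hg ▸ norm_add_le _ _
  have n4 : q * m * ‖g‖ ≤ q * m * ‖f‖ + q * m * ‖T‖ := by
    rw [← mul_add]; gcongr
  obtain ⟨Y, hY⟩ : ∃ Y, Y = m * ‖y‖ := ⟨_, rfl⟩
  obtain ⟨G, hG⟩ : ∃ G, G = q * m * ‖g‖ := ⟨_, rfl⟩
  obtain ⟨H, hH⟩ : ∃ H, H = q * m * ‖g0‖ := ⟨_, rfl⟩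
  have hY0 : 0 ≤ Y := by rw [hY]; positivity
  have hG0 : 0 ≤ G := by rw [hG]; positivity
  have hH0 : 0 ≤ H := by rw [hH]; positivity
  rw [← hY, ← hG, ← hH] at n2
  rw [← hG] at n4
  have n5 : (1 - c) * G ≤ c * (A + Y + (1 - s) * H) := by linarith
  have hW : 0 ≤ (1 - s) * H := mul_nonneg (by linarith) hH0
  have n6 : G ≤ 0.2 * (A + Y + (1 - s) * H) := by
    have : c * (A + Y + (1 - s) * H) ≤ 0.16162 * (A + Y + (1 - s) * H) := by gcongr
    have : (1 - 0.16162) * G ≤ (1 - c) * G := by gcongr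
    linarith
  have n7 : G ^ 2 ≤ (0.2 * (A + Y + (1 - s) * H)) ^ 2 := by gcongr
  have n8 : ((1 - s) * H) ^ 2 * 0.16 ≤ b * (1 - s) * H ^ 2 := by
    have h1 : (1 - s) * 0.16 ≤ b := by linarith
    have h2 := mul_le_mul_of_nonneg_right h1 (by linarith : 0 ≤ 1 - s)
    linarith [mul_le_mul_of_nonneg_right h2 (sq_nonneg H)]
  have n9 : (0.2 * (A + Y + (1 - s) * H)) ^ 2 ≤ A ^ 2 / 2 + Y ^ 2 + ((1 - s) * H) ^ 2 * 0.16 := by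
    have gen : ∀ W : ℝ, (0.2 * (A + Y + W)) ^ 2 ≤ A ^ 2 / 2 + Y ^ 2 + W ^ 2 * 0.16 := by
      clear * -
      intro W
      nlinarith [sq_nonneg (A - Y), sq_nonneg (A - W), sq_nonneg (Y - W), sq_nonneg A,
        sq_nonneg Y, sq_nonneg W]
    exact gen _
  have : m ^ 2 * ‖y‖ ^ 2 + 2 * a - (q * m) ^ 2 * ‖g‖ ^ 2 + b * (1 - s) * (q * m) ^ 2 * ‖g0‖ ^ 2
    = Y ^ 2 + 2 * a - G ^ 2 + b * (1 - s) * H ^ 2 := by rw [hY, hG, hH]; ring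
  rw [this]
  linarith

theorem nod_alg (s q τ : ℝ) (hs : 0 < s) (hτ : τ = (1 - s) / (1 + s)) (x z zh g : ℕ → E)
    (r1 : ∀ k, z (k + 1) = x k - (s * q) • g k)
    (r2 : ∀ k, x (k + 1) = z (k + 1) + τ • (z (k + 1) - z k))
    (r3 : ∀ k, zh (k + 1) = x (k + 1) + (1 / s - 1) • (x (k + 1) - x k)) (k : ℕ) (p : E) :
    (x (k + 1) + (1 / s) • (x (k + 1) - z (k + 1)) - p
      = (1 - s) • (x k + (1 / s) • (x k - z k) - p) + s • (x k - p) - q • g k) ∧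
    (s • (x (k + 1) + (1 / s) • (x (k + 1) - z (k + 1)) - p - (x (k + 1) - p))
      = x (k + 1) - z (k + 1)) ∧
    (x (k + 1) - z (k + 1) = x (k + 1) - p - (x k - p) + (s * q) • g k) ∧
    ((1 - s) • (x (k + 1) + (1 / s) • (x (k + 1) - z (k + 1)) - p) + s • (x (k + 1) - p)
      - (zh (k + 1) - p) = (q * (1 - s)) • g k) ∧
    (x (k + 1) - z (k + 1) = τ • (x k - z k - (s * q) • g k)) ∧
    (zh (k + 2) - zh (k + 1) = -(τ • (x (k + 1) - z (k + 1))) - (2 / (1 + s) * q) • g (k + 1)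
      + ((1 - s) * q) • g k) := by
  have hs' : s ≠ 0 := hs.ne'
  have hs1 : 1 + s ≠ 0 := by positivity
  refine ⟨?_, ?_, ?_, ?_, ?_, ?_⟩
  · rw [r2, r1, hτ]
    match_scalars <;> field_simp <;> ring
  · match_scalars <;> field_simp <;> ring
  · rw [r1]; module
  · rw [r3, r1]
    match_scalars <;> field_simp <;> ring
  · rw [r2, r1]; module
  · have hx : x k = z (k + 1) + (s * q) • g k := by rw [r1]; module
    rw [r3 (k + 1), r3 k, r2 (k + 1), r1 (k + 1), hx, hτ]
    match_scalars <;> field_simp <;> ring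

end nodaux


/-- Corollary 4.3 / `cor:discretize` of the paper.
Under the NOD setup, for every `K ≥ 2`,
`(μ/2)‖z̃_{K−1} − z⋆‖² ≤ (1 − √(ημ))^{K−2} · Ψ_2`, i.e. `‖z̃_{K−1} − z⋆‖²`
converges to `0` linearly with contraction factor `1 − √(ημ)`. -/
theorem nod_linear_convergence
    (d : ℕ) (hd : 1 ≤ d) (μ Lφ LS : ℝ) (hμ : 0 < μ) (hLφ : 0 < Lφ) (hLS : 0 < LS)
    (φ : EuclideanSpace ℝ (Fin d) → ℝ)
    (S : EuclideanSpace ℝ (Fin d) → EuclideanSpace ℝ (Fin d))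
    (zstar : EuclideanSpace ℝ (Fin d))
    (hφdiff : Differentiable ℝ φ)
    (hφsc : ∀ u v : EuclideanSpace ℝ (Fin d),
      φ v ≥ φ u + ⟪gradient φ u, v - u⟫ + μ / 2 * ‖v - u‖ ^ 2)
    (hφsmooth : ∀ u v : EuclideanSpace ℝ (Fin d),
      ‖gradient φ u - gradient φ v‖ ≤ Lφ * ‖u - v‖)
    (hSmono : ∀ u v : EuclideanSpace ℝ (Fin d), ⟪S u - S v, u - v⟫ ≥ 0)
    (hSlip : ∀ u v : EuclideanSpace ℝ (Fin d), ‖S u - S v‖ ≤ LS * ‖u - v‖)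
    (hstar : gradient φ zstar + S zstar = 0)
    (C B η : ℝ)
    (hC0 : 0 < C) (hC1 : C < 1)
    (hCeq : 1 - C - Real.sqrt C * (C + 6) = 0)
    (hB : B = Real.sqrt C / (1 - C))
    (hη : 0 < η) (hηle : η ≤ C * min (1 / Lφ) (μ / LS ^ 2))
    (z ztil zhat : ℕ → EuclideanSpace ℝ (Fin d))
    (hinit1 : ztil 0 = z 0) (hinit2 : zhat 0 = z 0)
    (hrec1 : ∀ k : ℕ, z (k + 1) = ztil k - η • (gradient φ (ztil k) + S (zhat k)))
    (hrec2 : ∀ k : ℕ, ztil (k + 1) = z (k + 1)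
      + ((1 - Real.sqrt (η * μ)) / (1 + Real.sqrt (η * μ))) • (z (k + 1) - z k))
    (hrec3 : ∀ k : ℕ, zhat (k + 1) = ztil (k + 1)
      + (1 / Real.sqrt (η * μ) - 1) • (ztil (k + 1) - ztil k))
    (Ψ : ℕ → ℝ)
    (hΨ : ∀ k : ℕ, 2 ≤ k → Ψ k =
      μ * ‖ztil k + (1 / Real.sqrt (η * μ)) • (ztil k - z k) - zstar‖ ^ 2
      + 2 * (φ (ztil (k - 1)) - φ zstar - ⟪gradient φ zstar, ztil (k - 1) - zstar⟫)
      - η * ‖gradient φ (ztil (k - 1)) + S (zhat (k - 1))‖ ^ 2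
      + (1 - η * μ) * Real.sqrt (μ / η) * ‖ztil (k - 1) - z (k - 1)‖ ^ 2
      + B * η * (1 - Real.sqrt (η * μ)) * (1 - η * Lφ)
        * ‖gradient φ (ztil (k - 2)) + S (zhat (k - 2))‖ ^ 2) :
    ∀ K : ℕ, 2 ≤ K →
      μ / 2 * ‖ztil (K - 1) - zstar‖ ^ 2 ≤ (1 - Real.sqrt (η * μ)) ^ (K - 2) * Ψ 2 := by
  intro K hK
  obtain ⟨s, hs⟩ : ∃ s, s = Real.sqrt (η * μ) := ⟨_, rfl⟩
  obtain ⟨m, hm⟩ : ∃ m, m = Real.sqrt μ := ⟨_, rfl⟩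
  obtain ⟨q, hq⟩ : ∃ q, q = Real.sqrt η / Real.sqrt μ := ⟨_, rfl⟩
  obtain ⟨c, hc⟩ : ∃ c, c = Real.sqrt C := ⟨_, rfl⟩
  obtain ⟨b, hb⟩ : ∃ b, b = B * (1 - η * Lφ) := ⟨_, rfl⟩
  have hm0 : 0 < m := hm ▸ Real.sqrt_pos.2 hμ
  have hq0 : 0 < q := hq ▸ div_pos (Real.sqrt_pos.2 hη) (Real.sqrt_pos.2 hμ)
  have hc0 : 0 < c := hc ▸ Real.sqrt_pos.2 hC0
  have hCc : C = c ^ 2 := by rw [hc, Real.sq_sqrt hC0.le]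
  have hm2 : m ^ 2 = μ := by rw [hm, Real.sq_sqrt hμ.le]
  have hqm' : q * m = Real.sqrt η := by
    rw [hq, hm]; exact div_mul_cancel₀ _ (Real.sqrt_pos.2 hμ).ne'
  have hqm : (q * m) ^ 2 = η := by rw [hqm', Real.sq_sqrt hη.le]
  have hsq : s = m ^ 2 * q := by
    rw [hs, Real.sqrt_mul hη.le, ← hm, ← hqm']; ring
  have hs0 : 0 < s := by rw [hsq]; positivity
  have hηs : η = s * q := by rw [← hqm, hsq]; ring
  have hs2 : s ^ 2 = η * μ := by rw [hs, Real.sq_sqrt (by positivity)]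
  have hrt : Real.sqrt (μ / η) = m ^ 2 / s := by
    rw [Real.sqrt_div hμ.le, ← hm, ← hqm', hsq]; field_simp
  have hCe : 1 - c ^ 2 - c * (c ^ 2 + 6) = 0 := by rw [← hCc, hc]; exact hCeq
  have hηL : η * Lφ ≤ C := by
    have h1 : η ≤ C * (1 / Lφ) := hηle.trans (by gcongr; exact min_le_left _ _)
    calc η * Lφ ≤ C * (1 / Lφ) * Lφ := by gcongr
      _ = C := by field_simp
  have hηS : η * LS ^ 2 ≤ C * μ := by
    have h1 : η ≤ C * (μ / LS ^ 2) := hηle.trans (by gcongr; exact min_le_right _ _)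
    calc η * LS ^ 2 ≤ C * (μ / LS ^ 2) * LS ^ 2 := by gcongr
      _ = C * μ := by field_simp
  have hqLS : q * LS ≤ c := by
    refine (sq_le_sq₀ (by positivity) (by positivity)).1 ?_
    rw [← hCc]
    have : (q * LS) ^ 2 * m ^ 2 ≤ C * m ^ 2 := by
      calc (q * LS) ^ 2 * m ^ 2 = (q * m) ^ 2 * LS ^ 2 := by ring
        _ = η * LS ^ 2 := by rw [hqm]
        _ ≤ C * m ^ 2 := by rw [hm2]; exact hηS
    exact le_of_mul_le_mul_right this (by positivity)
  have hμL : μ ≤ Lφ := by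
    have : Nonempty (Fin d) := ⟨⟨0, hd⟩⟩
    obtain ⟨w, hw⟩ := exists_ne (0 : EuclideanSpace ℝ (Fin d))
    have h1 := hφsc 0 w
    have h2 := nod_descent φ Lφ hφdiff hφsmooth 0 w
    rw [sub_zero] at h1 h2
    have h3 : 0 < ‖w‖ ^ 2 := by have := norm_pos_iff.2 hw; positivity
    have h4 : μ * ‖w‖ ^ 2 ≤ Lφ * ‖w‖ ^ 2 := by linarith
    exact le_of_mul_le_mul_right h4 h3
  have hsc : s ≤ c := by
    rw [hs, hc]
    apply Real.sqrt_le_sqrt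
    calc η * μ ≤ η * Lφ := by gcongr
      _ ≤ C := hηL
  have hc1 : c < 1 := by nlinarith only [hCe, hc0, sq_nonneg c]
  have hBC : B * (1 - C) = c := by
    rw [hB, hc]; exact div_mul_cancel₀ _ (by linarith)
  have hB0 : 0 < B := by
    have h : 0 < B * (1 - C) := by rw [hBC]; exact hc0
    exact (pos_iff_pos_of_mul_pos h).2 (by linarith)
  have hB6 : B * (C + 6) = 1 := by
    have h : B * (C + 6) * (1 - C) = 1 * (1 - C) := by
      calc B * (C + 6) * (1 - C) = (B * (1 - C)) * (C + 6) := by ring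
        _ = c * (C + 6) := by rw [hBC]
        _ = 1 * (1 - C) := by rw [hCc]; linarith
    exact mul_right_cancel₀ (by linarith : (1 - C) ≠ 0) h
  have hb1 : c ≤ b := by
    rw [hb, ← hBC]; gcongr
  have hb2 : b * (C + 6) ≤ 1 := by
    rw [← hB6, hb]
    have : B * (1 - η * Lφ) ≤ B * 1 := by
      gcongr
      have : 0 < η * Lφ := by positivity
      linarith
    have h6 : 0 ≤ C + 6 := by linarith
    calc _ ≤ B * 1 * (C + 6) := by gcongr
      _ = _ := by ring
  have hCs : C < 1 / 2 := by nlinarith only [hCe, hc0, sq_nonneg c, hCc]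
  obtain ⟨M, hM⟩ : ∃ M, M * (1 - 2 * C) = 2 * C :=
    ⟨2 * C / (1 - 2 * C), div_mul_cancel₀ _ (by linarith)⟩
  obtain ⟨τ, hτ⟩ : ∃ τ, τ = (1 - s) / (1 + s) := ⟨_, rfl⟩
  have hτ' : τ * (1 + s) = 1 - s := by rw [hτ]; exact div_mul_cancel₀ _ (by linarith)
  have hconv : ∀ u v, φ v ≥ φ u + ⟪gradient φ u, v - u⟫ := fun u v => by
    have := hφsc u v
    have h2 : 0 ≤ μ / 2 * ‖v - u‖ ^ 2 := by positivity
    linarith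
  have hcoco := nod_coco φ Lφ hLφ hφdiff hφsmooth hconv
  obtain ⟨g, hg⟩ : ∃ g : ℕ → EuclideanSpace ℝ (Fin d),
    ∀ k, gradient φ (ztil k) + S (zhat k) = g k := ⟨_, fun k => rfl⟩
  have hgs : ∀ k, g k = (gradient φ (ztil k) - gradient φ zstar) + (S (zhat k) - S zstar) := by
    intro k
    rw [← hg k, ← sub_zero (gradient φ (ztil k) + S (zhat k)), ← hstar]; abel
  have alg := nod_alg s q τ hs0 hτ ztil z zhat g (fun k => by rw [hrec1, hg, hηs])
    (fun k => by rw [hτ, hs]; exact hrec2 k) (fun k => by rw [hs]; exact hrec3 k)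
  have hqs : s * q = (q * m) ^ 2 := by rw [hsq]; ring
  rw [hqs] at alg
  rw [← hs]
  obtain ⟨a, ha⟩ : ∃ a : ℕ → ℝ, ∀ k, φ (ztil k) - φ zstar - ⟪gradient φ zstar, ztil k - zstar⟫ = a k :=
    ⟨_, fun k => rfl⟩
  have hΨ' : ∀ k, Ψ (k + 2) = m ^ 2 * ‖ztil (k + 2) + (1 / s) • (ztil (k + 2) - z (k + 2)) - zstar‖ ^ 2
      + 2 * a (k + 1) - (q * m) ^ 2 * ‖g (k + 1)‖ ^ 2
      + (1 - s ^ 2) / s * m ^ 2 * ‖ztil (k + 1) - z (k + 1)‖ ^ 2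
      + b * (1 - s) * (q * m) ^ 2 * ‖g k‖ ^ 2 := by
    intro k
    rw [hΨ (k + 2) (by omega)]
    have i1 : k + 2 - 1 = k + 1 := by omega
    have i2 : k + 2 - 2 = k := by omega
    rw [i1, i2, hg, hg, ha, hrt, ← hs, ← hs2, hm2, hqm, hb]
    ring
  have hpos : ∀ k, μ / 2 * ‖ztil (k + 1) - zstar‖ ^ 2 ≤ Ψ (k + 2) := by
    intro k
    have h1 : μ / 2 * ‖ztil (k + 1) - zstar‖ ^ 2 ≤ a (k + 1) := by
      rw [← ha]; linarith [hφsc zstar (ztil (k + 1))]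
    refine h1.trans ?_
    have ha0 : 0 ≤ a (k + 1) := le_trans (by positivity) h1
    obtain ⟨-, -, -, h4, -, -⟩ := alg k zstar
    obtain ⟨h5, -⟩ := alg (k + 1) zstar
    have hcc := hcoco zstar (ztil (k + 1))
    have := nod_pos C c b s m q Lφ LS (a (k + 1)) hc0 hCc hCe hb1 hm0 hq0 hs0 hsc hLφ
      (by rw [hqm]; exact hηL) hqLS hLS.le ha0
      (ztil (k + 2) + (1 / s) • (ztil (k + 2) - z (k + 2)) - zstar) (g k) (g (k + 1))
      (gradient φ (ztil (k + 1)) - gradient φ zstar) (S (zhat (k + 1)) - S zstar)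
      (zhat (k + 1) - zstar) (hgs _)
      (by
        rw [norm_sub_rev]
        have : 1 / (2 * Lφ) * ‖gradient φ zstar - gradient φ (ztil (k + 1))‖ ^ 2 ≤ a (k + 1) := by
          rw [← ha]; linarith
        rw [one_div_mul_eq_div, div_le_iff₀ (by positivity)] at this
        linarith)
      (hSlip _ _) (by rw [h5, ← h4]; module)
    rw [hΨ' k]
    have h7 : 0 ≤ (1 - s ^ 2) / s * m ^ 2 * ‖ztil (k + 1) - z (k + 1)‖ ^ 2 := by
      have : 0 ≤ 1 - s ^ 2 := by nlinarith only [hs0, hsc, hc1]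
      positivity
    linarith
  have hcon : ∀ k, Ψ (k + 3) ≤ (1 - s) * Ψ (k + 2) := by
    intro k
    obtain ⟨-, -, -, -, -, e6⟩ := alg k zstar
    obtain ⟨-, e2, e3, e4, e5, -⟩ := alg (k + 1) zstar
    obtain ⟨e1, -⟩ := alg (k + 2) zstar
    have st := nod_step m q s hsq hs0 (by linarith)
      (ztil (k + 2) + (1 / s) • (ztil (k + 2) - z (k + 2)) - zstar) (ztil (k + 2) - zstar)
      (ztil (k + 1) - zstar) (g (k + 2)) (g (k + 1))
      (gradient φ (ztil (k + 2)) - gradient φ zstar) (S (zhat (k + 2)) - S zstar)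
      (zhat (k + 2) - zstar) (a (k + 2)) (a (k + 1))
      (1 / (2 * Lφ) * ‖gradient φ (ztil (k + 2)) - gradient φ (ztil (k + 1))‖ ^ 2)
      (e2.trans e3) e4 (hgs _)
      (by
        have h := hφsc (ztil (k + 2)) zstar
        rw [hm2, ← ha, inner_sub_left, norm_sub_rev]
        rw [← neg_sub (ztil (k + 2)) zstar, inner_neg_right, neg_sub] at h
        linarith)
      (by
        have h := hcoco (ztil (k + 2)) (ztil (k + 1))
        rw [← ha, ← ha]
        simp only [inner_sub_left, inner_sub_right] at h ⊢
        linarith)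
      (hSmono _ _)
    have vc := nod_vec C c b M s τ m q Lφ LS hc0 hCc hCe hb1 hb2 hM hm0 hq0 hsq hsc hτ' hLφ
      (by rw [hqm]; exact hηL) hqLS hLS.le (ztil (k + 1) - z (k + 1)) (ztil (k + 2) - z (k + 2))
      (g k) (g (k + 1)) (g (k + 2)) (gradient φ (ztil (k + 2)) - gradient φ (ztil (k + 1)))
      (S (zhat (k + 2)) - S (zhat (k + 1))) (zhat (k + 2) - zhat (k + 1)) e5
      (by rw [← hg, ← hg]; abel) (hSlip _ _) e6
    have hP : Ψ (k + 3) = m ^ 2 * ‖ztil (k + 3) + (1 / s) • (ztil (k + 3) - z (k + 3)) - zstar‖ ^ 2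
      + 2 * a (k + 2) - (q * m) ^ 2 * ‖g (k + 2)‖ ^ 2
      + (1 - s ^ 2) / s * m ^ 2 * ‖ztil (k + 2) - z (k + 2)‖ ^ 2
      + b * (1 - s) * (q * m) ^ 2 * ‖g (k + 1)‖ ^ 2 := hΨ' (k + 1)
    rw [hP, hΨ' k]
    have e1' : ztil (k + 3) + (1 / s) • (ztil (k + 3) - z (k + 3)) - zstar = _ := e1
    rw [← e1'] at st
    have hn := congrArg norm e2
    rw [norm_smul, Real.norm_of_nonneg hs0.le] at hn
    change s * ‖ztil (k + 2) + (1 / s) • (ztil (k + 2) - z (k + 2)) - zstar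
      - (ztil (k + 2) - zstar)‖ = ‖ztil (k + 2) - z (k + 2)‖ at hn
    have h1s : 0 ≤ 1 - s := by linarith
    have vc' := mul_le_mul_of_nonneg_left vc h1s
    have hr : (1 - s ^ 2) / s * s = 1 - s ^ 2 := div_mul_cancel₀ _ hs0.ne'
    have hl : 2 * (1 - s) * (1 / (2 * Lφ)
        * ‖gradient φ (ztil (k + 2)) - gradient φ (ztil (k + 1))‖ ^ 2)
      = (1 - s) * (1 / Lφ * ‖gradient φ (ztil (k + 2)) - gradient φ (ztil (k + 1))‖ ^ 2) := by
      field_simp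
    rw [hl] at st
    rw [← hn] at vc' ⊢
    generalize (1 - s ^ 2) / s = r at *
    generalize ‖ztil (k + 2) + (1 / s) • (ztil (k + 2) - z (k + 2)) - zstar
      - (ztil (k + 2) - zstar)‖ = n at *
    have hk : r * m ^ 2 * (s * n) ^ 2 = m ^ 2 * s * (1 - s ^ 2) * n ^ 2 := by
      rw [← hr]; ring
    rw [hk]
    linarith
  have hall : ∀ n, Ψ (n + 2) ≤ (1 - s) ^ n * Ψ 2 := by
    intro n
    induction n with
    | zero => simp
    | succ n ih =>
      calc Ψ (n + 1 + 2) ≤ (1 - s) * Ψ (n + 2) := hcon n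
        _ ≤ (1 - s) * ((1 - s) ^ n * Ψ 2) := mul_le_mul_of_nonneg_left ih (by linarith)
        _ = _ := by ring
  obtain ⟨n, rfl⟩ : ∃ n, K = n + 2 := ⟨K - 2, by omega⟩
  have i1 : n + 2 - 1 = n + 1 := by omega
  have i2 : n + 2 - 2 = n := by omega
  rw [i1, i2]
  exact (hpos n).trans (hall n)
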